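/- arXiv:1309.1899 — 2 statements merged into one kernel-verified Lean document; each statement's English description precedes it below -/
import Mathlib

section
/- Let n, d, s ≥ 1, let l₁, …, l_s ∈ ℂ^{n+1} be nonzero, pairwise non-proportional vectors, and write ℓᵢ = Σⱼ lᵢⱼ xⱼ for the corresponding linear forms. Let f ∈ ℂ[x₀,…,x_n] be homogeneous of degree d. Then f lies in the linear span of ℓ₁^d, …, ℓ_s^d (i.e., f = Σᵢ λᵢ ℓᵢ^d for some λᵢ ∈ ℂ) if and only if every homogeneous polynomial g ∈ ℂ[x₀,…,x_n] with g(lᵢ) = 0 for all i = 1, …, s satisfies g∘f = 0; that is, if and only if the homogeneous vanishing ideal of the point set {[l₁],…,[l_s]} is contained in the apolar ideal of f. (Apolarity Lemma, Lemma 1.2 of the paper.) -/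
open MvPolynomial

/-- The constant-coefficient differential operator associated with the monomial
exponent `d`: the composition over `i` of `(∂/∂xᵢ)^(d i)`. -/
noncomputable def monOp {n : ℕ} (d : Fin n →₀ ℕ) :
    Module.End ℂ (MvPolynomial (Fin n) ℂ) :=
  (List.ofFn fun i : Fin n =>
    ((pderiv (R := ℂ) i).toLinearMap : Module.End ℂ (MvPolynomial (Fin n) ℂ)) ^ (d i)).prod

/-- The apolarity action `g ∘ f` : apply `g`, viewed as a constant-coefficient
differential operator, to `f`. -/
noncomputable def apolar {n : ℕ} (g f : MvPolynomial (Fin n) ℂ) :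
    MvPolynomial (Fin n) ℂ :=
  ∑ d ∈ g.support, coeff d g • monOp d f

/-- The apolarity pairing `⟨f, k⟩ := k ∘ f` (its constant term). -/
noncomputable def pairing {n : ℕ} (f k : MvPolynomial (Fin n) ℂ) : ℂ :=
  eval (fun _ => (0 : ℂ)) (apolar k f)

/-- The linear form `Σ vᵢ xᵢ` associated with a vector `v`. -/
noncomputable def linForm {n : ℕ} (v : Fin n → ℂ) : MvPolynomial (Fin n) ℂ :=
  ∑ i, MvPolynomial.C (v i) * X i

/-- The directional partial derivative `∂_v f = Σ vᵢ ∂f/∂xᵢ`. -/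
noncomputable def pdir {n : ℕ} (v : Fin n → ℂ) (f : MvPolynomial (Fin n) ℂ) :
    MvPolynomial (Fin n) ℂ :=
  ∑ i, MvPolynomial.C (v i) * pderiv i f

/-- The Veronese map `ν : ℂ³ → ℂ⁶`. -/
noncomputable def nu (w : Fin 3 → ℂ) : Fin 6 → ℂ :=
  ![w 0 ^ 2, 2 * w 0 * w 1, 2 * w 0 * w 2, w 1 ^ 2, 2 * w 1 * w 2, w 2 ^ 2]

/-- The components of the Veronese map as quadratic forms in `y₀, y₁, y₂`. -/
noncomputable def nuPoly : Fin 6 → MvPolynomial (Fin 3) ℂ :=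
  ![X 0 ^ 2, 2 * X 0 * X 1, 2 * X 0 * X 2, X 1 ^ 2, 2 * X 1 * X 2, X 2 ^ 2]

/-- A quadratic form `q` in 6 variables has rank `≤ r`: there is a symmetric matrix
`M` of rank `≤ r` with `q(x) = xᵀ M x`. -/
def QuadRankLe (q : MvPolynomial (Fin 6) ℂ) (r : ℕ) : Prop :=
  ∃ M : Matrix (Fin 6) (Fin 6) ℂ, M.IsSymm ∧ M.rank ≤ r ∧
    ∀ x : Fin 6 → ℂ, eval x q = ∑ i, ∑ j, M i j * x i * x j

/-- `s` is the linear map carrying a ternary sextic `g` to the cubic `s(g)` in six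
variables, characterized by `⟨s(g), k⟩ = ⟨g, m(k)⟩` for all cubic forms `k`, where
`m(k) = k ∘ ν`. -/
def IsSMap (s : MvPolynomial (Fin 3) ℂ →ₗ[ℂ] MvPolynomial (Fin 6) ℂ) : Prop :=
  (∀ g : MvPolynomial (Fin 3) ℂ, g.IsHomogeneous 6 → (s g).IsHomogeneous 3) ∧
  ∀ g : MvPolynomial (Fin 3) ℂ, ∀ k : MvPolynomial (Fin 6) ℂ,
    g.IsHomogeneous 6 → k.IsHomogeneous 3 →
      pairing (s g) k = pairing g (aeval nuPoly k)

/-- Evaluation of a polynomial function `P` in the coefficients at a polynomial `g`. -/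
noncomputable def evalCoeff {σ : Type} (g : MvPolynomial σ ℂ) (P : MvPolynomial (σ →₀ ℕ) ℂ) : ℂ :=
  eval (fun d => coeff d g) P

/-- The vanishing ideal of a subset of `ℂ⁵⁶`. -/
noncomputable def vanishingIdealOf (S : Set (Fin 56 → ℂ)) : Ideal (MvPolynomial (Fin 56) ℂ) :=
  ⨅ x ∈ S, RingHom.ker (eval x)

/-- An ideal is a prime ideal of height one: it is prime, admits a prime strictly
below it, and admits no chain of two primes strictly below it. -/
def IsHeightOnePrime {R : Type*} [CommRing R] (I : Ideal R) : Prop :=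
  I.IsPrime ∧ (∃ p : Ideal R, p.IsPrime ∧ p < I) ∧
    ∀ p q : Ideal R, p.IsPrime → q.IsPrime → p < q → ¬ q < I

/-- The space `Q_{f,U}` of quadratic forms vanishing on `U` and apolar to `f`. -/
def QfU (f : MvPolynomial (Fin 6) ℂ) (U : Submodule ℂ (Fin 6 → ℂ)) :
    Set (MvPolynomial (Fin 6) ℂ) :=
  {q | q.IsHomogeneous 2 ∧ (∀ u ∈ U, eval u q = 0) ∧ apolar q f = 0}

/-- The Zariski closure of a subset of `ℂ⁵⁶`. -/
def zcl (S : Set (Fin 56 → ℂ)) : Set (Fin 56 → ℂ) :=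
  {x | ∀ P : MvPolynomial (Fin 56) ℂ, (∀ y ∈ S, eval y P = 0) → eval x P = 0}

/-- The projection of a polynomial onto its squarefree monomials. -/
noncomputable def sqfreeProj (f : MvPolynomial (Fin 6) ℂ) : MvPolynomial (Fin 6) ℂ :=
  ∑ d ∈ f.support.filter (fun d => ∀ i, d i ≤ 1), monomial d (coeff d f)


/-- Iterated partial derivatives of a monomial. -/
theorem pderiv_pow_monomial {n : ℕ} (i : Fin n) (k : ℕ) (t : Fin n →₀ ℕ) (a : ℂ) :
    (((pderiv (R := ℂ) i).toLinearMap : Module.End ℂ (MvPolynomial (Fin n) ℂ)) ^ k)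
        (monomial t a) =
      monomial (t - Finsupp.single i k) (a * ((t i).descFactorial k : ℂ)) := by
  induction k with
  | zero => simp
  | succ k ih =>
    rw [pow_succ', Module.End.mul_apply, ih]
    simp only [Derivation.coeFn_coe, pderiv_monomial]
    rw [tsub_tsub, ← Finsupp.single_add, Nat.descFactorial_succ]
    congr 1
    simp
    ring

theorem list_prod_pderiv_pow_monomial {n : ℕ} (m : Fin n →₀ ℕ) (L : List (Fin n))
    (hL : L.Nodup) (t : Fin n →₀ ℕ) (a : ℂ) :
    (L.map fun i => ((pderiv (R := ℂ) i).toLinearMap :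
        Module.End ℂ (MvPolynomial (Fin n) ℂ)) ^ (m i)).prod (monomial t a) =
      monomial (t - (L.map fun i => Finsupp.single i (m i)).sum)
        (a * (L.map fun i => ((t i).descFactorial (m i) : ℂ)).prod) := by
  induction L with
  | nil => simp
  | cons j L ih =>
    obtain ⟨hj, hL⟩ := List.nodup_cons.mp hL
    have hsum : (L.map fun i => Finsupp.single i (m i)).sum j = 0 := by
      rw [← Finsupp.applyAddHom_apply, map_list_sum, List.map_map]
      refine List.sum_eq_zero fun x hx => ?_
      obtain ⟨i, hi, rfl⟩ := List.mem_map.mp hx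
      exact Finsupp.single_eq_of_ne fun hji => hj (hji ▸ hi)
    rw [List.map_cons, List.prod_cons, Module.End.mul_apply, ih hL, pderiv_pow_monomial,
      tsub_tsub, Finsupp.tsub_apply, hsum]
    simp only [List.map_cons, List.sum_cons, List.prod_cons, Nat.sub_zero]
    rw [add_comm, mul_assoc, mul_comm (List.prod _)]

theorem monOp_monomial {n : ℕ} (m t : Fin n →₀ ℕ) (a : ℂ) :
    monOp m (monomial t a) =
      monomial (t - m) (a * ∏ i, ((t i).descFactorial (m i) : ℂ)) := by
  rw [monOp, List.ofFn_eq_map, list_prod_pderiv_pow_monomial m _ (List.nodup_finRange n),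
    ← Fin.sum_univ_def, ← Fin.prod_univ_def, Finsupp.univ_sum_single]

/-- A monomial operator of order `d` sends a form of degree `d` to a multiple of the
corresponding coefficient. -/
theorem monOp_of_isHomogeneous {n d : ℕ} {h : MvPolynomial (Fin n) ℂ}
    (hh : h.IsHomogeneous d) {m : Fin n →₀ ℕ} (hm : m.degree = d) :
    monOp m h = C ((∏ i, ((m i).factorial : ℂ)) * coeff m h) := by
  have hne : ∀ t ∈ h.support, t ≠ m → monOp m (monomial t (coeff t h)) = 0 := by
    intro t ht htm
    have htd : t.degree = d := by
      rw [Finsupp.degree_eq_weight_one]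
      exact hh (mem_support_iff.mp ht)
    obtain ⟨i, hi⟩ : ∃ i, t i < m i := by
      by_contra! hle
      refine htm (Finsupp.ext fun i => ?_)
      rw [Finsupp.degree_eq_sum] at hm htd
      exact (((Finset.sum_eq_sum_iff_of_le fun i _ => hle i).mp (hm.trans htd.symm)) i
        (Finset.mem_univ i)).symm
    rw [monOp_monomial, Finset.prod_eq_zero (Finset.mem_univ i)
      (by rw [Nat.descFactorial_of_lt hi, Nat.cast_zero]), mul_zero, monomial_zero]
  conv_lhs => rw [h.as_sum, map_sum]
  rw [Finset.sum_eq_single m hne, monOp_monomial]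
  · simp [Nat.descFactorial_self, mul_comm]
  · intro hm'
    rw [notMem_support_iff.mp hm', monomial_zero, map_zero]

theorem pderiv_linForm {n : ℕ} (v : Fin n → ℂ) (i : Fin n) :
    pderiv i (linForm v) = C (v i) := by
  classical
  simp [linForm, Pi.single_apply]

theorem pderiv_pow_linForm_pow {n : ℕ} (v : Fin n → ℂ) (i : Fin n) (k d : ℕ) :
    (((pderiv (R := ℂ) i).toLinearMap : Module.End ℂ (MvPolynomial (Fin n) ℂ)) ^ k)
        (linForm v ^ d) =
      ((d.descFactorial k : ℂ) * v i ^ k) • linForm v ^ (d - k) := by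
  induction k with
  | zero => simp
  | succ k ih =>
    rw [pow_succ', Module.End.mul_apply, ih, map_smul, Derivation.coeFn_coe, pderiv_pow,
      pderiv_linForm, Nat.descFactorial_succ, smul_eq_C_mul, smul_eq_C_mul, Nat.sub_sub]
    simp only [map_mul, map_pow, Nat.cast_mul, map_natCast]
    ring

theorem list_prod_pderiv_pow_linForm_pow {n : ℕ} (v : Fin n → ℂ) (m : Fin n →₀ ℕ)
    (L : List (Fin n)) (d : ℕ) :
    (L.map fun i => ((pderiv (R := ℂ) i).toLinearMap :
        Module.End ℂ (MvPolynomial (Fin n) ℂ)) ^ (m i)).prod (linForm v ^ d) =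
      ((d.descFactorial (L.map m).sum : ℂ) * (L.map fun i => v i ^ m i).prod) •
        linForm v ^ (d - (L.map m).sum) := by
  induction L with
  | nil => simp
  | cons j L ih =>
    rw [List.map_cons, List.prod_cons, Module.End.mul_apply, ih, map_smul,
      pderiv_pow_linForm_pow, smul_smul, Nat.sub_sub]
    simp only [List.map_cons, List.sum_cons, List.prod_cons]
    rw [add_comm (m j), ← Nat.descFactorial_mul_descFactorial
      (Nat.le_add_right (L.map m).sum (m j)), Nat.add_sub_cancel_left, Nat.cast_mul]
    congr 1
    ring

theorem monOp_linForm_pow {n : ℕ} (v : Fin n → ℂ) (m : Fin n →₀ ℕ) (d : ℕ) :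
    monOp m (linForm v ^ d) =
      ((d.descFactorial m.degree : ℂ) * ∏ i, v i ^ m i) • linForm v ^ (d - m.degree) := by
  rw [monOp, List.ofFn_eq_map, list_prod_pderiv_pow_linForm_pow, ← Fin.sum_univ_def,
    ← Fin.prod_univ_def, Finsupp.degree_eq_sum]

/-- The apolarity action of a form of degree `e` on a power of a linear form. -/
theorem apolar_linForm_pow {n e : ℕ} {g : MvPolynomial (Fin n) ℂ} (hg : g.IsHomogeneous e)
    (v : Fin n → ℂ) (d : ℕ) :
    apolar g (linForm v ^ d) =
      ((d.descFactorial e : ℂ) * eval v g) • linForm v ^ (d - e) := by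
  rw [apolar, eval_eq', Finset.mul_sum, Finset.sum_smul]
  refine Finset.sum_congr rfl fun m hm => ?_
  have hme : m.degree = e := by
    rw [Finsupp.degree_eq_weight_one]
    exact hg (mem_support_iff.mp hm)
  rw [monOp_linForm_pow, hme, smul_smul]
  congr 1
  ring

theorem apolar_sum_smul {n : ℕ} {ι : Type*} (S : Finset ι) (g : MvPolynomial (Fin n) ℂ)
    (c : ι → ℂ) (p : ι → MvPolynomial (Fin n) ℂ) :
    apolar g (∑ i ∈ S, c i • p i) = ∑ i ∈ S, c i • apolar g (p i) := by
  simp only [apolar, map_sum, map_smul, Finset.smul_sum]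
  rw [Finset.sum_comm]
  exact Finset.sum_congr rfl fun i _ => Finset.sum_congr rfl fun m _ => smul_comm _ _ _

/-- Every linear functional on forms of degree `d` is given by the apolarity action of
some form of degree `d`. -/
theorem exists_apolar_eq_functional {n : ℕ} (d : ℕ) (φ : MvPolynomial (Fin n) ℂ →ₗ[ℂ] ℂ) :
    ∃ g : MvPolynomial (Fin n) ℂ, g.IsHomogeneous d ∧
      ∀ h : MvPolynomial (Fin n) ℂ, h.IsHomogeneous d → apolar g h = C (φ h) := by
  classical
  let A : Finset (Fin n →₀ ℕ) := Finset.finsuppAntidiag Finset.univ d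
  have hA : ∀ m, m ∈ A ↔ m.degree = d := fun m => by
    simp [A, Finset.mem_finsuppAntidiag, Finsupp.degree_eq_sum]
  let c : (Fin n →₀ ℕ) → ℂ := fun m => φ (monomial m 1) / ∏ i, ((m i).factorial : ℂ)
  let g : MvPolynomial (Fin n) ℂ := ∑ m ∈ A, monomial m (c m)
  have hcoeff : ∀ m, coeff m g = if m ∈ A then c m else 0 := fun m => by
    simp [g, coeff_sum, coeff_monomial]
  have hsupp : g.support ⊆ A := fun m hm => by
    by_contra hmA
    exact mem_support_iff.mp hm (by rw [hcoeff, if_neg hmA])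
  refine ⟨g, IsHomogeneous.sum _ _ _ fun m hm =>
    isHomogeneous_monomial _ ((hA m).mp hm), fun h hh => ?_⟩
  have hsupp' : h.support ⊆ A := fun m hm => by
    rw [hA, Finsupp.degree_eq_weight_one]
    exact hh (mem_support_iff.mp hm)
  have hφ : φ h = ∑ m ∈ A, coeff m h * φ (monomial m 1) := by
    conv_lhs => rw [h.as_sum, map_sum]
    rw [← Finset.sum_subset hsupp' fun m _ hm => by
      rw [notMem_support_iff.mp hm, zero_mul]]
    refine Finset.sum_congr rfl fun m _ => ?_
    rw [← smul_eq_mul, ← map_smul, smul_monomial, smul_eq_mul, mul_one]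
  rw [apolar, Finset.sum_subset hsupp fun m _ hm => by
    rw [notMem_support_iff.mp hm, zero_smul], hφ, map_sum]
  refine Finset.sum_congr rfl fun m hm => ?_
  have hfac : (∏ i, ((m i).factorial : ℂ)) ≠ 0 :=
    Finset.prod_ne_zero_iff.mpr fun i _ => Nat.cast_ne_zero.mpr (Nat.factorial_ne_zero _)
  rw [monOp_of_isHomogeneous hh ((hA m).mp hm), hcoeff, if_pos hm, smul_eq_C_mul, ← C_mul]
  congr 1
  simp only [c]
  field_simp

theorem isHomogeneous_linForm {n : ℕ} (v : Fin n → ℂ) : (linForm v).IsHomogeneous 1 :=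
  IsHomogeneous.sum _ _ _ fun i _ => isHomogeneous_C_mul_X (v i) i

/-- **Apolarity Lemma** (Lemma 1.2). `f` lies in the span of the `d`-th powers of the
linear forms `ℓᵢ` iff every homogeneous polynomial vanishing at all the points `lᵢ`
is apolar to `f`. -/
theorem statement0 (n d s : ℕ) (hn : 1 ≤ n) (hd : 1 ≤ d) (hs : 1 ≤ s)
    (l : Fin s → (Fin (n + 1) → ℂ)) (hl0 : ∀ i, l i ≠ 0)
    (hprop : ∀ i j, i ≠ j → ∀ c : ℂ, l i ≠ c • l j)
    (f : MvPolynomial (Fin (n + 1)) ℂ) (hf : f.IsHomogeneous d) :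
    (∃ lam : Fin s → ℂ, f = ∑ i, lam i • linForm (l i) ^ d) ↔
      (∀ g : MvPolynomial (Fin (n + 1)) ℂ, (∃ e : ℕ, g.IsHomogeneous e) →
        (∀ i, eval (l i) g = 0) → apolar g f = 0) := by
  constructor
  · rintro ⟨lam, rfl⟩ g ⟨e, hg⟩ hvan
    rw [apolar_sum_smul]
    refine Finset.sum_eq_zero fun i _ => ?_
    rw [apolar_linForm_pow hg, hvan i, mul_zero, zero_smul, smul_zero]
  · intro H
    by_contra hnot
    have hspan : f ∉ Submodule.span ℂ (Set.range fun i => linForm (l i) ^ d) := fun hmem => by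
      obtain ⟨lam, hlam⟩ := (Submodule.mem_span_range_iff_exists_fun ℂ).mp hmem
      exact hnot ⟨lam, hlam.symm⟩
    obtain ⟨φ, hφf, hφ⟩ := Submodule.exists_le_ker_of_notMem hspan
    obtain ⟨g, hg, hgφ⟩ := exists_apolar_eq_functional d φ
    have hvan : ∀ i, eval (l i) g = 0 := fun i => by
      have hpow : (linForm (l i) ^ d).IsHomogeneous d := by
        simpa using (isHomogeneous_linForm (l i)).pow d
      have hzero : φ (linForm (l i) ^ d) = 0 := hφ (Submodule.subset_span ⟨i, rfl⟩)
      have happ := apolar_linForm_pow hg (l i) d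
      rw [hgφ _ hpow, hzero, C_0, Nat.sub_self, pow_zero, smul_eq_C_mul, mul_one, eq_comm,
        C_eq_zero, Nat.descFactorial_self] at happ
      exact (mul_eq_zero.mp happ).resolve_left
        (Nat.cast_ne_zero.mpr (Nat.factorial_ne_zero d))
    have hgf := H g ⟨d, hg⟩ hvan
    rw [hgφ f hf, C_eq_zero] at hgf
    exact hφf hgf
end

section
/- A cubic form f ∈ ℂ[x₀,…,x₅] is apolar to the standard Veronese surface if and only if it lies in the image of the map s. Precisely, the following are equivalent: (i) ⟨f,k⟩ = 0 for every cubic form k ∈ ℂ[x₀,…,x₅] that vanishes identically on the Veronese cone ν(ℂ³); (ii) there exists a sextic form g ∈ ℂ[y₀,y₁,y₂] such that ⟨f,k⟩ = ⟨g, m(k)⟩ for every cubic form k ∈ ℂ[x₀,…,x₅]. (Lemma 1.5 of the paper.) -/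
open MvPolynomial

/-- Iterated partial derivatives shift coefficients, up to a nonzero factor. -/
lemma exists_coeff_pderiv_pow {n : ℕ} (i : Fin n) (m : ℕ) (e : Fin n →₀ ℕ) :
    ∃ c : ℂ, c ≠ 0 ∧ ∀ f : MvPolynomial (Fin n) ℂ,
      coeff e ((((pderiv (R := ℂ) i).toLinearMap :
        Module.End ℂ (MvPolynomial (Fin n) ℂ)) ^ m) f) =
        c * coeff (e + Finsupp.single i m) f := by
  induction m generalizing e with
  | zero => exact ⟨1, one_ne_zero, fun f => by simp⟩
  | succ m ih =>
    obtain ⟨c, hc, h⟩ := ih (e + Finsupp.single i 1)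
    refine ⟨((e i : ℂ) + 1) * c, mul_ne_zero (by exact_mod_cast (e i).succ_ne_zero) hc,
      fun f => ?_⟩
    rw [pow_succ', Module.End.mul_apply]
    refine (coeff_pderiv _ e).trans ?_
    rw [h, add_assoc, ← Finsupp.single_add, add_comm 1 m]
    ring

/-- Compositions of iterated partial derivatives shift coefficients, up to a nonzero factor. -/
lemma exists_coeff_list_prod_pderiv {n : ℕ} (d : Fin n →₀ ℕ) (l : List (Fin n))
    (e : Fin n →₀ ℕ) :
    ∃ c : ℂ, c ≠ 0 ∧ ∀ f : MvPolynomial (Fin n) ℂ,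
      coeff e ((l.map fun i => ((pderiv (R := ℂ) i).toLinearMap :
        Module.End ℂ (MvPolynomial (Fin n) ℂ)) ^ (d i)).prod f) =
        c * coeff (e + (l.map fun i => Finsupp.single i (d i)).sum) f := by
  induction l generalizing e with
  | nil => exact ⟨1, one_ne_zero, fun f => by simp⟩
  | cons i l ih =>
    obtain ⟨c, hc, h⟩ := exists_coeff_pderiv_pow i (d i) e
    obtain ⟨c', hc', h'⟩ := ih (e + Finsupp.single i (d i))
    refine ⟨c * c', mul_ne_zero hc hc', fun f => ?_⟩
    rw [List.map_cons, List.prod_cons, Module.End.mul_apply, h, h', List.map_cons,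
      List.sum_cons, add_assoc, mul_assoc]

/-- The constant term of `monOp d f` is a nonzero multiple of the `d`-th coefficient of `f`. -/
lemma exists_eval_zero_monOp {n : ℕ} (d : Fin n →₀ ℕ) :
    ∃ c : ℂ, c ≠ 0 ∧ ∀ f : MvPolynomial (Fin n) ℂ,
      eval (fun _ => (0 : ℂ)) (monOp d f) = c * coeff d f := by
  obtain ⟨c, hc, h⟩ := exists_coeff_list_prod_pderiv d (List.finRange n) 0
  refine ⟨c, hc, fun f => ?_⟩
  have hd : ((List.finRange n).map fun i => Finsupp.single i (d i)).sum = d := by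
    rw [← List.ofFn_eq_map, List.sum_ofFn, Finsupp.univ_sum_single]
  have h0 := h f
  rw [zero_add, hd, ← List.ofFn_eq_map] at h0
  rw [← h0]
  exact RingHom.congr_fun eval_zero' (monOp d f)

lemma pairing_eq_sum {n : ℕ} (f k : MvPolynomial (Fin n) ℂ) :
    pairing f k = ∑ d ∈ k.support, coeff d k * eval (fun _ => (0 : ℂ)) (monOp d f) := by
  simp [pairing, apolar]

/-- The pairing with `f` as a linear functional. -/
noncomputable def pairingLinear {n : ℕ} (f : MvPolynomial (Fin n) ℂ) :
    Module.Dual ℂ (MvPolynomial (Fin n) ℂ) :=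
  (basisMonomials (Fin n) ℂ).constr ℂ fun d => eval (fun _ => (0 : ℂ)) (monOp d f)

lemma pairingLinear_apply {n : ℕ} (f k : MvPolynomial (Fin n) ℂ) :
    pairingLinear f k = pairing f k := by
  rw [pairing_eq_sum, pairingLinear, Module.Basis.constr_apply]
  rfl

/-- Every linear functional agrees, on forms of degree `m`, with the pairing against some form
of degree `m`. -/
lemma exists_isHomogeneous_pairing_eq {n : ℕ} (m : ℕ)
    (φ : Module.Dual ℂ (MvPolynomial (Fin n) ℂ)) :
    ∃ g : MvPolynomial (Fin n) ℂ, g.IsHomogeneous m ∧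
      ∀ k : MvPolynomial (Fin n) ℂ, k.IsHomogeneous m → pairing g k = φ k := by
  choose c hc h using exists_eval_zero_monOp (n := n)
  let S := Finset.finsuppAntidiag (Finset.univ : Finset (Fin n)) m
  have hS (d : Fin n →₀ ℕ) : d ∈ S ↔ d.degree = m := by
    simp [S, Finset.mem_finsuppAntidiag, Finsupp.degree_eq_sum]
  refine ⟨∑ d ∈ S, monomial d ((c d)⁻¹ * φ (monomial d 1)),
    IsHomogeneous.sum _ _ _ fun d hd => isHomogeneous_monomial _ ((hS d).1 hd), fun k hk => ?_⟩
  rw [pairing_eq_sum]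
  conv_rhs => rw [k.as_sum, map_sum]
  refine Finset.sum_congr rfl fun d hd => ?_
  have hdS : d ∈ S := (hS d).2 <| by
    by_contra hne
    exact mem_support_iff.1 hd (hk.coeff_eq_zero hne)
  have hmon : monomial d (coeff d k) = coeff d k • monomial d (1 : ℂ) := by
    rw [smul_monomial, smul_eq_mul, mul_one]
  rw [h, coeff_sum, Finset.sum_eq_single d, coeff_monomial, if_pos rfl,
    mul_inv_cancel_left₀ (hc d), hmon, map_smul, smul_eq_mul]
  · intro b _ hb
    rw [coeff_monomial, if_neg hb]
  · exact fun hd' => absurd hdS hd'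

lemma eval_nuPoly (w : Fin 3 → ℂ) (i : Fin 6) : eval w (nuPoly i) = nu w i := by
  fin_cases i <;> simp [nuPoly, nu]

lemma eval_aeval_nuPoly (w : Fin 3 → ℂ) (k : MvPolynomial (Fin 6) ℂ) :
    eval w (aeval nuPoly k) = eval (nu w) k := by
  induction k using MvPolynomial.induction_on with
  | C a => simp
  | add p q hp hq => simp only [map_add, hp, hq]
  | mul_X p i hp => simp only [map_mul, hp, aeval_X, eval_X, eval_nuPoly]

lemma aeval_nuPoly_eq_zero_iff (k : MvPolynomial (Fin 6) ℂ) :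
    aeval nuPoly k = 0 ↔ ∀ w : Fin 3 → ℂ, eval (nu w) k = 0 := by
  simp_rw [← eval_aeval_nuPoly]
  exact ⟨fun h w => by rw [h, map_zero], fun h => MvPolynomial.funext fun w => by rw [h, map_zero]⟩

lemma isHomogeneous_nuPoly (i : Fin 6) : (nuPoly i).IsHomogeneous 2 := by
  have hX (a b : Fin 3) : (X a * X b : MvPolynomial (Fin 3) ℂ).IsHomogeneous 2 :=
    (isHomogeneous_X ℂ a).mul (isHomogeneous_X ℂ b)
  have h2 (a b : Fin 3) : (2 * X a * X b : MvPolynomial (Fin 3) ℂ).IsHomogeneous 2 := by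
    rw [mul_assoc, two_mul]
    exact (hX a b).add (hX a b)
  have hsq (a : Fin 3) : (X a ^ 2 : MvPolynomial (Fin 3) ℂ).IsHomogeneous 2 := by
    rw [sq]
    exact hX a a
  fin_cases i
  exacts [hsq 0, h2 0 1, h2 0 2, hsq 1, h2 1 2, hsq 2]

/-- **Lemma 1.5.** A cubic form `f` in six variables is apolar to the standard Veronese
surface iff it is in the image of the map `s`, i.e. iff there is a ternary sextic `g`
with `⟨f, k⟩ = ⟨g, m(k)⟩` for all cubic forms `k`. -/
theorem statement1 (f : MvPolynomial (Fin 6) ℂ) (hf : f.IsHomogeneous 3) :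
    (∀ k : MvPolynomial (Fin 6) ℂ, k.IsHomogeneous 3 →
        (∀ w : Fin 3 → ℂ, eval (nu w) k = 0) → pairing f k = 0) ↔
      (∃ g : MvPolynomial (Fin 3) ℂ, g.IsHomogeneous 6 ∧
        ∀ k : MvPolynomial (Fin 6) ℂ, k.IsHomogeneous 3 →
          pairing f k = pairing g (aeval nuPoly k)) := by
  constructor
  · intro h
    let V := homogeneousSubmodule (Fin 6) ℂ 3
    let m : V →ₗ[ℂ] MvPolynomial (Fin 3) ℂ := (aeval nuPoly).toLinearMap ∘ₗ V.subtype
    have hmem : (pairingLinear f) ∘ₗ V.subtype ∈ LinearMap.range m.dualMap := by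
      rw [LinearMap.range_dualMap_eq_dualAnnihilator_ker, Submodule.mem_dualAnnihilator]
      intro k hk
      exact (pairingLinear_apply f k).trans
        (h k k.2 ((aeval_nuPoly_eq_zero_iff k).1 hk))
    obtain ⟨φ, hφ⟩ := hmem
    obtain ⟨g, hg, hgφ⟩ := exists_isHomogeneous_pairing_eq 6 φ
    refine ⟨g, hg, fun k hk => ?_⟩
    rw [hgφ _ (hk.aeval nuPoly isHomogeneous_nuPoly), ← pairingLinear_apply]
    exact (LinearMap.congr_fun hφ ⟨k, hk⟩).symm
  · rintro ⟨g, -, hg⟩ k hk hw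
    rw [hg k hk, (aeval_nuPoly_eq_zero_iff k).2 hw, ← pairingLinear_apply, map_zero]
end
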